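/- Let q be a prime power, h ≥ 2, and L₁, L₂ be disjoint subsets of PG(2, q^h), each projectively equivalent to the trace-construction blocking set. Then every point of L₁ ∪ L₂ lies on at least q^h − q^{h-1} − q^{h-2} lines meeting L₁ ∪ L₂ in exactly 2 points. In particular L₁ ∪ L₂ is a minimal double blocking set. -/

import Mathlib

/-- The relative trace `x ↦ x + x^q + ⋯ + x^{q^{h-1}}`. -/
def Tr (q h : ℕ) {K : Type*} [Field K] (x : K) : K :=
  ∑ i ∈ Finset.range h, x ^ q ^ i

/-- The line of `PG(2, K)` with equation `a 0 * X + a 1 * Y + a 2 * Z = 0`. -/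
def projLine {K : Type*} [Field K] (a : Fin 3 → K) :
    Set (Projectivization K (Fin 3 → K)) :=
  {P | ∑ i, a i * P.rep i = 0}

/-- A subset of `PG(2, K)` is a line if it is `projLine a` for some nonzero `a`. -/
def IsLine {K : Type*} [Field K] (ℓ : Set (Projectivization K (Fin 3 → K))) : Prop :=
  ∃ a : Fin 3 → K, a ≠ 0 ∧ ℓ = projLine a

/-- The trace-construction point set
`{(x : Tr(x) : y) : x ∈ F_{q^h}, y ∈ F_q, (x,y) ≠ (0,0)}` in `PG(2, q^h)`. -/
def traceSet (q h : ℕ) (F K : Type*) [Field F] [Field K] [Algebra F K] :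
    Set (Projectivization K (Fin 3 → K)) :=
  {P | ∃ (x : K) (y : F), (x ≠ 0 ∨ y ≠ 0) ∧
    ∃ hv : (![x, Tr q h x, algebraMap F K y] : Fin 3 → K) ≠ 0,
      P = Projectivization.mk K (![x, Tr q h x, algebraMap F K y]) hv}

/-- `L` is projectively equivalent to the trace construction. -/
def ProjEquivTrace (q h : ℕ) (F K : Type*) [Field F] [Field K] [Algebra F K]
    (L : Set (Projectivization K (Fin 3 → K))) : Prop :=
  ∃ σ : (Fin 3 → K) ≃ₗ[K] (Fin 3 → K),
    Projectivization.map σ.toLinearMap σ.injective '' traceSet q h F K = L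

section Secants

open Configuration Finset

variable {P L : Type*} [Membership P L]

/-- Combinatorial features of a set of points in a projective plane of order `q ^ 2 * k`, as enjoyed
by the points of a linear set with a point `H` of large weight. -/
structure IsHeavyBlockingSet (L : Type*) [Membership P L] (q k : ℕ) (S : Set P) : Prop where
  ncard_le : S.ncard ≤ q ^ 2 * k + q * k + 1
  blocking : ∀ l : L, ∃ p ∈ S, p ∈ l
  secant : ∀ l : L, ∀ p ∈ S, ∀ r ∈ S, p ≠ r → p ∈ l → r ∈ l → q + 1 ≤ (S ∩ {x | x ∈ l}).ncard
  heavy : ∃ H ∈ S, ∀ l : L, H ∈ l → ∀ r ∈ S, r ≠ H → r ∈ l →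
    q * k + 1 ≤ (S ∩ {x | x ∈ l}).ncard

theorem sum_ncard_inter_le_ncard [Nondegenerate P L] [Finite P] (B : Finset L) (p : P)
    (hB : ∀ l ∈ B, p ∈ l) (S : Set P) (hp : p ∉ S) :
    ∑ l ∈ B, (S ∩ {x | x ∈ l}).ncard ≤ S.ncard := by
  classical
  have := Fintype.ofFinite P
  have key : #(B.biUnion fun l => {x | x ∈ S ∧ x ∈ l}) = ∑ l ∈ B, #{x | x ∈ S ∧ x ∈ l} := by
    refine card_biUnion fun l hl m hm hlm => disjoint_left.2 fun x hx hx' => ?_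
    simp only [mem_filter, mem_univ, true_and] at hx hx'
    rcases Nondegenerate.eq_or_eq (hB l hl) hx.2 (hB m hm) hx'.2 with rfl | h
    · exact hp hx.1
    · exact hlm h
  have hcard (l : L) : (S ∩ {x | x ∈ l}).ncard = #{x | x ∈ S ∧ x ∈ l} := by
    rw [← Set.ncard_coe_finset]
    congr 1
    ext x
    simp
  simp_rw [hcard]
  rw [← key, ← Set.ncard_coe_finset]
  refine Set.ncard_le_ncard (fun x hx => ?_) (Set.toFinite _)
  simp only [coe_biUnion, Set.mem_iUnion, mem_coe, mem_filter] at hx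
  obtain ⟨l, -, hx⟩ := hx
  exact hx.2.1

namespace IsHeavyBlockingSet

variable {q k : ℕ} {S T : Set P}

theorem one_le_ncard [Finite P] (hS : IsHeavyBlockingSet L q k S) (l : L) :
    1 ≤ (S ∩ {x | x ∈ l}).ncard := by
  obtain ⟨p, hp, hpl⟩ := hS.blocking l
  exact (Set.ncard_pos (Set.toFinite _)).2 ⟨p, hp, hpl⟩

theorem lt_ncard_of_one_lt [Finite P] (hS : IsHeavyBlockingSet L q k S) {l : L}
    (hl : 1 < (S ∩ {x | x ∈ l}).ncard) : q < (S ∩ {x | x ∈ l}).ncard := by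
  obtain ⟨a, b, ha, hb, hab⟩ := (Set.one_lt_ncard_iff (Set.toFinite _)).1 hl
  exact hS.secant l a ha.1 b hb.1 hab ha.2 hb.2

open Classical in
theorem card_secants_le_of_notMem [Nondegenerate P L] [Finite P] [Fintype L] (hq : 0 < q)
    (hS : IsHeavyBlockingSet L q k S) {p : P} (hp : p ∉ S)
    (hcount : lineCount L p = q ^ 2 * k + 1) :
    #{l : L | p ∈ l ∧ 1 < (S ∩ {x | x ∈ l}).ncard} ≤ k := by
  have h1 : ∑ l : L with p ∈ l, (1 + if 1 < (S ∩ {x | x ∈ l}).ncard then q else 0) ≤ S.ncard := by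
    refine le_trans (sum_le_sum fun l _ => ?_)
      (sum_ncard_inter_le_ncard {l : L | p ∈ l} p (by simp) S hp)
    split_ifs with h
    · have := hS.lt_ncard_of_one_lt h
      omega
    · simpa using hS.one_le_ncard l
  have h2 : #{l : L | p ∈ l} = q ^ 2 * k + 1 := by
    rw [← hcount, lineCount, Nat.card_eq_fintype_card, Fintype.card_subtype]
  rw [sum_add_distrib, ← sum_filter, filter_filter, sum_const, sum_const, h2, smul_eq_mul,
    smul_eq_mul] at h1
  have := hS.ncard_le
  refine Nat.le_of_mul_le_mul_right (c := q) ?_ hq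
  linarith

open Classical in
theorem card_secants_le_of_mem [HasLines P L] [Finite P] [Fintype L] (hq : 0 < q) (hk : 0 < k)
    (hS : IsHeavyBlockingSet L q k S) {p : P} (hp : p ∈ S) :
    #{l : L | p ∈ l ∧ 1 < (S ∩ {x | x ∈ l}).ncard} ≤ q * k + 1 := by
  have hcard : (S \ {p}).ncard + 1 = S.ncard := Set.ncard_sdiff_singleton_add_one hp
  have hle := hS.ncard_le
  have hline (l : L) (hl : p ∈ l) :
      ((S \ {p}) ∩ {x | x ∈ l}).ncard + 1 = (S ∩ {x | x ∈ l}).ncard := by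
    rw [← Set.ncard_sdiff_singleton_add_one (s := S ∩ {x | x ∈ l}) (a := p) ⟨hp, hl⟩]
    congr 2
    ext x
    simp only [Set.mem_inter_iff, Set.mem_sdiff]
    tauto
  have hsum (B : Finset L) (hB : ∀ l ∈ B, p ∈ l) :=
    sum_ncard_inter_le_ncard B p hB (S \ {p}) (by simp)
  set B : Finset L := {l : L | p ∈ l ∧ 1 < (S ∩ {x | x ∈ l}).ncard} with hBdef
  have hB (l : L) (hl : l ∈ B) : p ∈ l ∧ 1 < (S ∩ {x | x ∈ l}).ncard := by simpa [hBdef] using hl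
  have hqk : q ≤ q * k := Nat.le_mul_of_pos_right q hk
  obtain ⟨H, hHS, hH⟩ := hS.heavy
  by_cases hpH : p = H
  · subst hpH
    have h1 : #B * (q * k) ≤ (S \ {p}).ncard := by
      rw [← smul_eq_mul, ← sum_const]
      refine le_trans (sum_le_sum fun l hl => ?_) (hsum B fun l hl => (hB l hl).1)
      obtain ⟨hpl, hl1⟩ := hB l hl
      obtain ⟨r, hr, hrp⟩ := Set.exists_ne_of_one_lt_ncard hl1 p
      have := hH l hpl r hr.1 hrp hr.2
      have := hline l hpl
      omega
    have h2 : #B ≤ q + 1 := by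
      refine Nat.le_of_mul_le_mul_right (c := q * k) ?_ (Nat.mul_pos hq hk)
      nlinarith
    omega
  · set l₀ : L := HasLines.mkLine hpH with hl₀
    obtain ⟨hpl₀, hHl₀⟩ : p ∈ l₀ ∧ H ∈ l₀ := HasLines.mkLine_ax hpH
    have h0 := hH l₀ hHl₀ p hp hpH hpl₀
    have h0' := hline l₀ hpl₀
    have h1 : #(B.erase l₀) * q + q * k ≤ (S \ {p}).ncard := by
      refine le_trans ?_ (hsum (insert l₀ (B.erase l₀)) ?_)
      · rw [sum_insert (by simp), add_comm, ← smul_eq_mul #(B.erase l₀), ← sum_const]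
        refine add_le_add (by omega) (sum_le_sum fun l hl => ?_)
        obtain ⟨hpl, hl1⟩ := hB l (mem_of_mem_erase hl)
        have := hS.lt_ncard_of_one_lt hl1
        have := hline l hpl
        omega
      · intro l hl
        rcases mem_insert.1 hl with rfl | hl
        · exact hpl₀
        · exact (hB l (mem_of_mem_erase hl)).1
    have h2 : #(B.erase l₀) ≤ q * k := by
      refine Nat.le_of_mul_le_mul_right (c := q) ?_ hq
      nlinarith
    have := pred_card_le_card_erase (s := B) (a := l₀)
    omega

open Classical in
theorem le_card_bisecants [HasLines P L] [Finite P] [Fintype L] (hq : 0 < q) (hk : 0 < k)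
    (hS : IsHeavyBlockingSet L q k S) (hT : IsHeavyBlockingSet L q k T) (hST : Disjoint S T)
    {p : P} (hp : p ∈ S) (hcount : lineCount L p = q ^ 2 * k + 1) :
    q ^ 2 * k - q * k - k ≤ #{l : L | p ∈ l ∧ ((S ∪ T) ∩ {x | x ∈ l}).ncard = 2} := by
  have h1 := hS.card_secants_le_of_mem hq hk hp
  have h2 := hT.card_secants_le_of_notMem hq (Set.disjoint_left.1 hST hp) hcount
  have h3 : #{l : L | p ∈ l} = q ^ 2 * k + 1 := by
    rw [← hcount, lineCount, Nat.card_eq_fintype_card, Fintype.card_subtype]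
  have h4 : ({l : L | p ∈ l} : Finset L) ⊆
      ({l : L | p ∈ l ∧ ((S ∪ T) ∩ {x | x ∈ l}).ncard = 2} : Finset L) ∪
      (({l : L | p ∈ l ∧ 1 < (S ∩ {x | x ∈ l}).ncard} : Finset L) ∪
        ({l : L | p ∈ l ∧ 1 < (T ∩ {x | x ∈ l}).ncard} : Finset L)) := by
    intro l hl
    have hS1 := hS.one_le_ncard l
    have hT1 := hT.one_le_ncard l
    have hu : ((S ∪ T) ∩ {x | x ∈ l}).ncard
        = (S ∩ {x | x ∈ l}).ncard + (T ∩ {x | x ∈ l}).ncard := by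
      rw [Set.union_inter_distrib_right]
      exact Set.ncard_union_eq (hST.mono Set.inter_subset_left Set.inter_subset_left)
    simp only [mem_filter, mem_univ, true_and, mem_union] at hl ⊢
    simp only [hl, true_and]
    omega
  have h5 := (card_le_card h4).trans (card_union_le _ _)
  have h6 := card_union_le ({l : L | p ∈ l ∧ 1 < (S ∩ {x | x ∈ l}).ncard} : Finset L)
    ({l : L | p ∈ l ∧ 1 < (T ∩ {x | x ∈ l}).ncard} : Finset L)
  omega

end IsHeavyBlockingSet

end Secants

section LinearSets

open Configuration Configuration.ofField

variable {F K V : Type*} [Field F] [Field K] [Algebra F K]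

theorem mem_projLine_rep_iff (p a : Projectivization K (Fin 3 → K)) :
    p ∈ projLine a.rep ↔ p ∈ a := by
  rw [mem_iff]
  conv_rhs => rw [← p.mk_rep, ← a.mk_rep, Projectivization.orthogonal_mk]
  simp only [projLine, Set.mem_ofPred_eq, dotProduct, mul_comm]

theorem mk_mem_iff {v : Fin 3 → K} (hv : v ≠ 0) (a : Projectivization K (Fin 3 → K)) :
    Projectivization.mk K v hv ∈ a ↔ v ⬝ᵥ a.rep = 0 := by
  rw [mem_iff]
  conv_lhs => rw [← a.mk_rep, Projectivization.orthogonal_mk]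

theorem projLine_mk_rep {a : Fin 3 → K} (ha : a ≠ 0) :
    projLine (Projectivization.mk K a ha).rep = projLine a := by
  obtain ⟨c, hc⟩ := Projectivization.exists_smul_eq_mk_rep K a ha
  ext p
  simp [projLine, ← hc, Units.smul_def, mul_assoc, ← Finset.mul_sum]

theorem lineCount_projectivization [Finite K] [DecidableEq K]
    (p : Projectivization K (Fin 3 → K)) :
    lineCount (Projectivization K (Fin 3 → K)) p = Nat.card K + 1 := by
  have := Fintype.ofFinite (Projectivization K (Fin 3 → K))
  have h1 := Projectivization.card_of_finrank K (Fin 3 → K) (n := 3) (by simp)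
  rw [Nat.card_eq_fintype_card, ProjectivePlane.card_points (Projectivization K (Fin 3 → K))
    (Projectivization K (Fin 3 → K))] at h1
  simp only [Finset.sum_range_succ, Finset.sum_range_zero] at h1
  rw [ProjectivePlane.lineCount_eq]
  nlinarith

variable [AddCommGroup V] [Module F V]

/-- The points of the projective plane spanned by the nonzero vectors in the range of `f`. -/
def linearSet (f : V →ₗ[F] (Fin 3 → K)) : Set (Projectivization K (Fin 3 → K)) :=
  {p | ∃ z, ∃ hz : f z ≠ 0, p = Projectivization.mk K (f z) hz}

variable {f : V →ₗ[F] (Fin 3 → K)}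

theorem exists_mem_linearSet_mem [Finite K] (hf : Function.Injective f)
    (hcard : Nat.card K < Nat.card V) (a : Projectivization K (Fin 3 → K)) :
    ∃ p ∈ linearSet f, p ∈ a := by
  have : Finite V := Nat.finite_of_card_ne_zero (by omega)
  obtain ⟨z, z', hzz, h⟩ : ∃ z z', f z ⬝ᵥ a.rep = f z' ⬝ᵥ a.rep ∧ z ≠ z' := by
    by_contra! h
    exact hcard.not_ge (Nat.card_le_card_of_injective (fun z => f z ⬝ᵥ a.rep) fun z z' => h z z')
  have hz : f (z - z') ≠ 0 := by
    rw [map_sub, sub_ne_zero]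
    exact hf.ne h
  refine ⟨_, ⟨z - z', hz, rfl⟩, ?_⟩
  rw [mk_mem_iff, map_sub, sub_dotProduct, hzz, sub_self]

/-- If the vectors of `W` all represent the point `⟨f w⟩`, then a line through that point and a
further point of the linear set contains more than `#W` points of the linear set. -/
theorem card_add_one_le_ncard_linearSet_inter [Finite K] (hf : Function.Injective f)
    (W : Submodule F V) {w : V} (hw : f w ≠ 0) (hW : ∀ v ∈ W, ∃ c : K, f v = c • f w)
    {a p : Projectivization K (Fin 3 → K)} (hwa : Projectivization.mk K (f w) hw ∈ a)
    (hp : p ∈ linearSet f) (hpw : p ≠ Projectivization.mk K (f w) hw) (hpa : p ∈ a) :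
    Nat.card W + 1 ≤ (linearSet f ∩ {x | x ∈ a}).ncard := by
  obtain ⟨z, hz, rfl⟩ := hp
  have hindep (c d : K) (h : c • f z = d • f w) : c = 0 := by
    by_contra hc
    refine hpw ((Projectivization.mk_eq_mk_iff' K _ _ hz hw).2 ⟨c⁻¹ * d, ?_⟩)
    rw [mul_smul, ← h, smul_smul, inv_mul_cancel₀ hc, one_smul]
  choose! c hc using hW
  have hne (v : V) (hv : v ∈ W) : f (z + v) ≠ 0 := fun h => by
    rw [map_add, hc v hv] at h
    exact one_ne_zero (hindep 1 (-c v) (by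
      rw [neg_smul, one_smul]
      exact eq_neg_of_add_eq_zero_left h))
  let g : W → Projectivization K (Fin 3 → K) := fun v =>
    Projectivization.mk K (f (z + v)) (hne v v.2)
  have hg : Function.Injective g := by
    intro v v' h
    obtain ⟨b, hb⟩ := (Projectivization.mk_eq_mk_iff' K _ _ _ _).1 h
    rw [map_add, map_add, hc v v.2, hc v' v'.2] at hb
    have hb1 := hindep (b - 1) (c v - b * c v') (by
      rw [sub_smul, sub_smul, mul_smul, one_smul, sub_eq_sub_iff_add_eq_add, ← smul_add, hb]
      exact add_comm _ _)
    rw [sub_eq_zero.1 hb1, one_smul, add_right_inj, ← hc v v.2, ← hc v' v'.2] at hb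
    exact Subtype.ext (hf hb.symm)
  have hHg : Projectivization.mk K (f w) hw ∉ Set.range g := by
    rintro ⟨v, hv⟩
    obtain ⟨b, hb⟩ := (Projectivization.mk_eq_mk_iff' K _ _ _ _).1 hv
    rw [map_add, hc v v.2] at hb
    refine one_ne_zero (hindep 1 (b - c v) ?_)
    rw [one_smul, sub_smul, hb, add_sub_cancel_right]
  rw [← Set.ncard_range_of_injective hg, ← Set.ncard_insert_of_notMem hHg (Set.toFinite _)]
  refine Set.ncard_le_ncard ?_ (Set.toFinite _)
  rintro _ (rfl | ⟨v, rfl⟩)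
  · exact ⟨⟨w, hw, rfl⟩, hwa⟩
  · refine ⟨⟨_, _, rfl⟩, ?_⟩
    rw [mk_mem_iff] at hpa hwa
    simp only [g, Set.mem_ofPred_eq, mk_mem_iff]
    rw [map_add, hc v v.2, add_dotProduct, hpa, smul_dotProduct, hwa, smul_zero, add_zero]

theorem mul_ncard_linearSet_le [Finite F] [Finite K] [Finite V] (hf : Function.Injective f)
    (W : Submodule F V) {w : V} (hw : f w ≠ 0) (hW : ∀ v ∈ W, ∃ c : K, f v = c • f w) :
    (Nat.card F - 1) * ((linearSet f).ncard - 1) ≤ Nat.card V - Nat.card W := by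
  classical
  have := Fintype.ofFinite F
  have := Fintype.ofFinite V
  have hne {z : V} (hz : z ∉ W) : f z ≠ 0 := by
    rw [Ne, ← f.map_zero, hf.eq_iff]
    rintro rfl
    exact hz W.zero_mem
  let H := Projectivization.mk K (f w) hw
  let g : V → Projectivization K (Fin 3 → K) := fun z =>
    if h : f z ≠ 0 then Projectivization.mk K (f z) h else H
  let s : Finset V := {z | z ∉ W}
  have h1 : (Nat.card F - 1) * (s.image g).card ≤ s.card := by
    refine Finset.mul_card_image_le_card s _ fun b hb => ?_
    obtain ⟨z, hz, rfl⟩ := Finset.mem_image.1 hb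
    have hzW : z ∉ W := by simpa [s] using hz
    rw [← Nat.card_units, Nat.card_eq_fintype_card, ← Finset.card_univ]
    refine Finset.card_le_card_of_injOn (fun c : Fˣ => c • z) (fun c _ => ?_) fun c _ d _ h => ?_
    · have hcz : c • z ∉ W := by
        rwa [Units.smul_def, W.smul_mem_iff c.ne_zero]
      simp only [s, Finset.coe_filter, Finset.mem_filter, Finset.mem_univ, true_and,
        Set.mem_ofPred_eq]
      refine ⟨hcz, ?_⟩
      simp only [g, dif_pos (hne hcz), dif_pos (hne hzW)]
      refine (Projectivization.mk_eq_mk_iff' K _ _ _ _).2 ⟨algebraMap F K c, ?_⟩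
      rw [Units.smul_def, map_smul, algebraMap_smul]
    · have hz0 : z ≠ 0 := fun h => hzW (h ▸ W.zero_mem)
      exact Units.ext (smul_left_injective F hz0 h)
  have h2 : (linearSet f).ncard ≤ (s.image g).card + 1 := by
    refine le_trans ?_ (Finset.card_insert_le H _)
    rw [← Set.ncard_coe_finset]
    refine Set.ncard_le_ncard ?_ (Set.toFinite _)
    rintro _ ⟨z, hz, rfl⟩
    rw [Finset.coe_insert, Finset.coe_image]
    by_cases hzW : z ∈ W
    · left
      obtain ⟨c, hc⟩ := hW z hzW
      exact (Projectivization.mk_eq_mk_iff' K _ _ _ _).2 ⟨c, hc.symm⟩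
    · right
      exact ⟨z, by simpa [s] using hzW, dif_pos hz⟩
  have h3 : s.card = Nat.card V - Nat.card W := by
    have : s = ({z | z ∈ W} : Finset V)ᶜ := by ext; simp [s]
    rw [this, Finset.card_compl, ← Fintype.card_subtype, Nat.card_eq_fintype_card,
      Nat.card_eq_fintype_card]
  rw [← h3]
  exact (Nat.mul_le_mul_left _ (by omega)).trans h1

theorem isHeavyBlockingSet_linearSet [Finite F] [Finite K] (hf : Function.Injective f)
    (W : Submodule F V) {w : V} (hw : f w ≠ 0) (hW : ∀ v ∈ W, ∃ c : K, f v = c • f w)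
    {k : ℕ} (hk : 0 < k) (hV : Nat.card V = Nat.card F ^ 3 * k)
    (hcW : Nat.card W = Nat.card F * k) (hK : Nat.card K = Nat.card F ^ 2 * k) :
    IsHeavyBlockingSet (Projectivization K (Fin 3 → K)) (Nat.card F) k (linearSet f) := by
  have hq : 1 < Nat.card F := Finite.one_lt_card
  have : Finite V := Nat.finite_of_card_ne_zero (by rw [hV]; positivity)
  refine ⟨?_, exists_mem_linearSet_mem hf ?_, ?_, ?_⟩
  · have h := mul_ncard_linearSet_le hf W hw hW
    rw [hV, hcW] at h
    obtain ⟨m, hm⟩ : ∃ m, Nat.card F = m + 1 := ⟨Nat.card F - 1, by omega⟩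
    rw [hm] at h hq ⊢
    have h' : (m + 1) ^ 3 * k - (m + 1) * k = m * ((m + 1) ^ 2 * k + (m + 1) * k) := by
      rw [Nat.sub_eq_iff_eq_add (by gcongr; exact Nat.le_self_pow (by norm_num) _)]
      ring
    rw [h', Nat.add_sub_cancel] at h
    have := Nat.le_of_mul_le_mul_left h (by omega)
    omega
  · rw [hV, hK]
    gcongr
    omega
  · rintro a p hp r ⟨z, hz, rfl⟩ hpr hpa hra
    have hz0 : z ≠ 0 := fun h => hz (by rw [h, map_zero])
    have h := card_add_one_le_ncard_linearSet_inter hf (F ∙ z) hz (fun v hv => ?_) hra hp hpr hpa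
    · rwa [Nat.card_congr (LinearEquiv.toSpanNonzeroSingleton F V z hz0).toEquiv.symm] at h
    · obtain ⟨c, rfl⟩ := Submodule.mem_span_singleton.1 hv
      exact ⟨algebraMap F K c, by rw [map_smul, algebraMap_smul]⟩
  · refine ⟨_, ⟨w, hw, rfl⟩, fun a ha r hr hrH hra => ?_⟩
    rw [← hcW]
    exact card_add_one_le_ncard_linearSet_inter hf W hw hW ha hr hrH hra

variable (F K) in
/-- The `F`-linear map `(x, y) ↦ (x, Tr x, y)`. -/
noncomputable def traceMap : K × F →ₗ[F] (Fin 3 → K) :=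
  LinearMap.pi ![LinearMap.fst F K F,
    Algebra.linearMap F K ∘ₗ Algebra.trace F K ∘ₗ LinearMap.fst F K F,
    Algebra.linearMap F K ∘ₗ LinearMap.snd F K F]

theorem traceMap_apply (z : K × F) :
    traceMap F K z = ![z.1, algebraMap F K (Algebra.trace F K z.1), algebraMap F K z.2] := by
  ext i
  fin_cases i <;> rfl

theorem injective_traceMap : Function.Injective (traceMap F K) := by
  intro z z' h
  rw [traceMap_apply, traceMap_apply] at h
  exact Prod.ext (congrFun h 0) ((algebraMap F K).injective (congrFun h 2))

theorem traceSet_eq_linearSet [Finite K] {q h : ℕ} (hcard : Nat.card F = q)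
    (hrank : Module.finrank F K = h) : traceSet q h F K = linearSet (traceMap F K) := by
  subst hcard hrank
  have hTr (x : K) (y : F) : ![x, Tr (Nat.card F) (Module.finrank F K) x, algebraMap F K y]
      = traceMap F K (x, y) := by
    rw [traceMap_apply, FiniteField.algebraMap_trace_eq_sum_pow]
    rfl
  ext p
  simp only [traceSet, linearSet, Set.mem_ofPred_eq, Prod.exists, hTr]
  refine exists₂_congr fun x y => and_iff_right_of_imp ?_
  rintro ⟨hv, -⟩
  contrapose! hv
  rw [hv.1, hv.2, Prod.mk_zero_zero, map_zero]

theorem ProjEquivTrace.isHeavyBlockingSet [Finite F] [Finite K] {q h : ℕ}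
    (hcard : Nat.card F = q) (hh : 2 ≤ h) (hrank : Module.finrank F K = h)
    {S : Set (Projectivization K (Fin 3 → K))} (hS : ProjEquivTrace q h F K S) :
    IsHeavyBlockingSet (Projectivization K (Fin 3 → K)) q (q ^ (h - 2)) S := by
  obtain ⟨σ, rfl⟩ := hS
  rw [traceSet_eq_linearSet hcard hrank]
  subst hcard
  obtain ⟨m, rfl⟩ : ∃ m, h = m + 2 := ⟨h - 2, by omega⟩
  rw [Nat.add_sub_cancel]
  have : FiniteDimensional F K := Module.Finite.of_finite
  have hq : 1 < Nat.card F := Finite.one_lt_card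
  let f : K × F →ₗ[F] (Fin 3 → K) := (σ.toLinearMap.restrictScalars F) ∘ₗ traceMap F K
  have hf : Function.Injective f := σ.injective.comp injective_traceMap
  have himage : Projectivization.map σ.toLinearMap σ.injective '' linearSet (traceMap F K)
      = linearSet f := by
    ext p
    constructor
    · rintro ⟨_, ⟨z, hz, rfl⟩, rfl⟩
      exact ⟨z, fun h => hz (σ.map_eq_zero_iff.1 h), rfl⟩
    · rintro ⟨z, hz, rfl⟩
      exact ⟨_, ⟨z, fun h => hz (σ.map_eq_zero_iff.2 h), rfl⟩, rfl⟩
  rw [himage]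
  let W : Submodule F (K × F) := (LinearMap.ker (Algebra.trace F K)).map (LinearMap.inl F K F)
  have hker : Module.finrank F (LinearMap.ker (Algebra.trace F K)) = m + 1 := by
    have := LinearMap.finrank_range_add_finrank_ker (Algebra.trace F K)
    rw [LinearMap.range_eq_top.2 (Algebra.trace_surjective F K), finrank_top,
      Module.finrank_self] at this
    omega
  have hcW : Nat.card W = Nat.card F * Nat.card F ^ m := by
    rw [← Nat.card_congr (Submodule.equivMapOfInjective (LinearMap.inl F K F)
      LinearMap.inl_injective _).toEquiv, Module.natCard_eq_pow_finrank (K := F), hker, pow_succ']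
  have hcK : Nat.card K = Nat.card F ^ 2 * Nat.card F ^ m := by
    rw [Module.natCard_eq_pow_finrank (K := F), hrank, ← pow_add, add_comm]
  have : Nontrivial W := by
    rw [← Finite.one_lt_card_iff_nontrivial, hcW]
    exact hq.trans_le (Nat.le_mul_of_pos_right _ (by positivity))
  obtain ⟨⟨w, hwW⟩, hw⟩ := exists_ne (0 : W)
  have hw0 : f w ≠ 0 := by
    rw [Ne, ← f.map_zero, hf.eq_iff]
    exact fun h => hw (Subtype.ext h)
  refine isHeavyBlockingSet_linearSet hf W hw0 (fun v hv => ?_) (by positivity) ?_ hcW hcK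
  · have hW (v : K × F) (hv : v ∈ W) : f v = v.1 • σ ![1, 0, 0] := by
      obtain ⟨x, hx, rfl⟩ := hv
      rw [← map_smul]
      refine congrArg σ ?_
      rw [traceMap_apply]
      simp [LinearMap.mem_ker.1 hx]
    have hw1 : w.1 ≠ 0 := fun h => hw0 (by rw [hW w hwW, h, zero_smul])
    exact ⟨v.1 * w.1⁻¹, by rw [hW v hv, hW w hwW, smul_smul, inv_mul_cancel_right₀ hw1]⟩
  · rw [Nat.card_prod, hcK]
    ring

end LinearSets

/-- If `L₁, L₂` are disjoint copies of the trace construction, then every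
point of `L₁ ∪ L₂` lies on at least `q^h − q^(h-1) − q^(h-2)` lines meeting `L₁ ∪ L₂`
in exactly two points; in particular `L₁ ∪ L₂` is a minimal double blocking set. -/
theorem stmt_7 {F K : Type*} [Field F] [Field K] [Algebra F K]
    [Fintype F] [Fintype K]
    (q h : ℕ) (hq : IsPrimePow q) (hcard : Fintype.card F = q)
    (hh : 2 ≤ h) (hrank : Module.finrank F K = h)
    (L₁ L₂ : Set (Projectivization K (Fin 3 → K)))
    (h₁ : ProjEquivTrace q h F K L₁) (h₂ : ProjEquivTrace q h F K L₂)
    (hdisj : Disjoint L₁ L₂) :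
    (∀ P ∈ L₁ ∪ L₂,
      q ^ h - q ^ (h - 1) - q ^ (h - 2) ≤
        {ℓ | IsLine ℓ ∧ P ∈ ℓ ∧ (ℓ ∩ (L₁ ∪ L₂)).ncard = 2}.ncard) ∧
    (∀ a : Fin 3 → K, a ≠ 0 → 2 ≤ (projLine a ∩ (L₁ ∪ L₂)).ncard) ∧
    (∀ P ∈ L₁ ∪ L₂, ∃ ℓ, IsLine ℓ ∧ P ∈ ℓ ∧ (ℓ ∩ (L₁ ∪ L₂)).ncard = 2) := by
  classical
  have hF : Nat.card F = q := by rw [Nat.card_eq_fintype_card, hcard]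
  have hS₁ := h₁.isHeavyBlockingSet hF hh hrank
  have hS₂ := h₂.isHeavyBlockingSet hF hh hrank
  have hq1 : 1 < q := hq.one_lt
  have := Fintype.ofFinite (Projectivization K (Fin 3 → K))
  have hline (a : Projectivization K (Fin 3 → K)) : {p | p ∈ a} = projLine a.rep :=
    Set.ext fun p => (mem_projLine_rep_iff p a).symm
  have hcK : Nat.card K = q ^ h := by
    rw [Module.natCard_eq_pow_finrank (K := F), hF, hrank]
  obtain ⟨m, rfl⟩ : ∃ m, h = m + 2 := ⟨h - 2, by omega⟩
  simp only [Nat.add_sub_cancel, show m + 2 - 1 = m + 1 by omega] at *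
  have hk : 0 < q ^ m := by positivity
  have hmain (P : Projectivization K (Fin 3 → K)) (hP : P ∈ L₁ ∪ L₂) :
      q ^ (m + 2) - q ^ (m + 1) - q ^ m ≤
        {ℓ | IsLine ℓ ∧ P ∈ ℓ ∧ (ℓ ∩ (L₁ ∪ L₂)).ncard = 2}.ncard := by
    have hcount := lineCount_projectivization P
    rw [hcK, pow_add, mul_comm] at hcount
    let B : Finset (Projectivization K (Fin 3 → K)) :=
      {l | P ∈ l ∧ ((L₁ ∪ L₂) ∩ {x | x ∈ l}).ncard = 2}
    have hB : q ^ 2 * q ^ m - q * q ^ m - q ^ m ≤ B.card := by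
      rcases hP with hP | hP
      · exact hS₁.le_card_bisecants (by omega) hk hS₂ hdisj hP hcount
      · have := hS₂.le_card_bisecants (by omega) hk hS₁ hdisj.symm hP hcount
        rwa [Set.union_comm] at this
    rw [show q ^ (m + 2) = q ^ 2 * q ^ m by ring, pow_succ' q m]
    refine hB.trans ?_
    rw [← Set.ncard_coe_finset]
    refine Set.ncard_le_ncard_of_injOn (fun a => projLine a.rep) (fun a ha => ?_)
      (fun a ha b _ hab => ?_) (Set.toFinite _)
    · obtain ⟨ha1, ha2⟩ := (Finset.mem_filter.1 ha).2
      refine ⟨⟨_, a.rep_nonzero, rfl⟩, (mem_projLine_rep_iff P a).2 ha1, ?_⟩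
      rw [← hline, Set.inter_comm, ha2]
    · obtain ⟨-, ha2⟩ := (Finset.mem_filter.1 ha).2
      obtain ⟨x, y, hx, hy, hxy⟩ := (Set.one_lt_ncard_iff (Set.toFinite _)).1 (ha2 ▸ one_lt_two)
      replace hab : {p | p ∈ a} = {p | p ∈ b} := by
        rw [hline, hline]
        exact hab
      have hxa : x ∈ a := hx.2
      have hya : y ∈ a := hy.2
      have hxb : x ∈ b := hab.subset hx.2
      have hyb : y ∈ b := hab.subset hy.2
      exact (Configuration.Nondegenerate.eq_or_eq hxa hya hxb hyb).resolve_left hxy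
  refine ⟨hmain, fun a ha => ?_, fun P hP => ?_⟩
  · rw [← projLine_mk_rep ha, ← hline, Set.inter_union_distrib_left, Set.ncard_union_eq
      (hdisj.mono Set.inter_subset_right Set.inter_subset_right), Set.inter_comm,
      Set.inter_comm _ L₂]
    have := hS₁.one_le_ncard (Projectivization.mk K a ha)
    have := hS₂.one_le_ncard (Projectivization.mk K a ha)
    omega
  · refine Set.nonempty_of_ncard_ne_zero (Nat.ne_of_gt (lt_of_lt_of_le ?_ (hmain P hP)))
    have : 2 * (q * q ^ m) ≤ q * (q * q ^ m) := Nat.mul_le_mul_right _ hq1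
    have : 2 * q ^ m ≤ q * q ^ m := Nat.mul_le_mul_right _ hq1
    rw [pow_succ' q (m + 1), pow_succ']
    omega
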